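/- Let μ₁, μ₂, ν be finite measures on ℝ with finite first moments, and suppose μ₁ + μ₂ ≤_E ν. Then μ₂ ≤_E ν - S^ν(μ₁), where S^ν(μ₁) is the shadow of μ₁ in ν. -/

import Mathlib

open MeasureTheory Set Filter

noncomputable def pot (eta : Measure ℝ) (k : ℝ) : ℝ := ∫ x, max (k - x) 0 ∂eta

noncomputable def cpot (eta : Measure ℝ) (k : ℝ) : ℝ := ∫ x, max (x - k) 0 ∂eta

/-- `c` is the convex hull (largest convex minorant) of `f`. -/
def IsConvexHull (f c : ℝ → ℝ) : Prop :=
  ConvexOn ℝ Set.univ c ∧ (∀ x, c x ≤ f x) ∧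
    ∀ g : ℝ → ℝ, ConvexOn ℝ Set.univ g → (∀ x, g x ≤ f x) → ∀ x, g x ≤ c x

/-- Convex order: `∫ f dη ≤ ∫ f dχ` for all convex `f` for which both integrals exist. -/
def Cx (eta chi : Measure ℝ) : Prop :=
  ∀ f : ℝ → ℝ, ConvexOn ℝ Set.univ f → Integrable f eta → Integrable f chi →
    ∫ x, f x ∂eta ≤ ∫ x, f x ∂chi

/-- Extended convex order: `∫ f dη ≤ ∫ f dχ` for all nonnegative convex `f`. -/
def ECx (eta chi : Measure ℝ) : Prop :=
  ∀ f : ℝ → ℝ, ConvexOn ℝ Set.univ f → (∀ x, 0 ≤ f x) →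
    ∫⁻ x, ENNReal.ofReal (f x) ∂eta ≤ ∫⁻ x, ENNReal.ofReal (f x) ∂chi

/-- The class `𝒟(a, b)`: nonnegative, nondecreasing, convex functions vanishing at `-∞`
and asymptotic to `a * z - b` at `+∞`. -/
def MemD (a b : ℝ) (f : ℝ → ℝ) : Prop :=
  ConvexOn ℝ Set.univ f ∧ Monotone f ∧ (∀ x, 0 ≤ f x) ∧
    Tendsto f atBot (nhds 0) ∧
    Tendsto (fun z => f z - (a * z - b)) atTop (nhds 0)

/-- `S` is the shadow of `μ` in `ν`. -/
def IsShadow (mu nu S : Measure ℝ) : Prop :=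
  Cx mu S ∧ S ≤ nu ∧ ∀ eta : Measure ℝ, Cx mu eta → eta ≤ nu → Cx S eta

/-- `T` is the counter-shadow of `μ` in `ν`. -/
def IsCounterShadow (mu nu T : Measure ℝ) : Prop :=
  Cx mu T ∧ T ≤ nu ∧ ∀ eta : Measure ℝ, Cx mu eta → eta ≤ nu → Cx eta T


lemma cx_supp {h : ℝ → ℝ} (hc : ConvexOn ℝ Set.univ h) (x y : ℝ) :
    h x + derivWithin h (Ioi x) x * (y - x) ≤ h y := by
  have hd := hc.hasDerivWithinAt_rightDeriv_of_mem_interior (x := x) (by simp)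
  rcases lt_trichotomy x y with hxy | rfl | hxy
  · have := hc.le_slope_of_hasDerivWithinAt_Ioi (mem_univ x) (mem_univ y) hxy hd
    rw [slope_def_field, le_div_iff₀ (by linarith)] at this
    linarith
  · simp
  · have h1 := hc.slope_le_of_hasDerivWithinAt_Iio (mem_univ y) (mem_univ x) hxy
      (hc.hasDerivWithinAt_leftDeriv_of_mem_interior (x := x) (by simp))
    have h2 := hc.leftDeriv_le_rightDeriv_of_mem_interior (x := x) (by simp)
    have := h1.trans h2
    rw [slope_def_field, div_le_iff₀ (by linarith)] at this
    linarith

lemma cx_cont {h : ℝ → ℝ} (hc : ConvexOn ℝ Set.univ h) : Continuous h :=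
  continuousOn_univ.1 (hc.continuousOn isOpen_univ)

lemma cx_mono {h : ℝ → ℝ} (hc : ConvexOn ℝ Set.univ h) :
    Monotone (fun x => derivWithin h (Ioi x) x) := by
  have := hc.monotoneOn_rightDeriv
  rw [interior_univ] at this
  exact monotoneOn_univ.1 this

lemma cx_rcont {h : ℝ → ℝ} (hc : ConvexOn ℝ Set.univ h) (x : ℝ) :
    ContinuousWithinAt (fun x => derivWithin h (Ioi x) x) (Ici x) x := by
  rw [ContinuousWithinAt]
  refine tendsto_order.2 ⟨fun a ha => ?_, fun b hb => ?_⟩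
  · filter_upwards [self_mem_nhdsWithin] with y hy
    exact lt_of_lt_of_le ha (cx_mono hc hy)
  · have hd := hc.hasDerivWithinAt_rightDeriv_of_mem_interior (x := x) (by simp)
    rw [hasDerivWithinAt_iff_tendsto_slope' (by simp)] at hd
    obtain ⟨z, hz, hxz⟩ := ((hd.eventually (gt_mem_nhds hb)).and self_mem_nhdsWithin).exists
    have hxz : x < z := hxz
    have hcs : ContinuousAt (fun y => (h z - h y) / (z - y)) x := by
      have := (cx_cont hc)
      refine ContinuousAt.div (by fun_prop) (by fun_prop) (by linarith)
    have h1 : ∀ᶠ y in nhds x, (h z - h y) / (z - y) < b := by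
      refine hcs.eventually (gt_mem_nhds ?_)
      rwa [slope_def_field] at hz
    filter_upwards [nhdsWithin_le_nhds h1, nhdsWithin_le_nhds (gt_mem_nhds hxz)] with y hy hyz
    refine lt_of_le_of_lt ?_ hy
    rw [le_div_iff₀ (by linarith)]
    have := cx_supp hc y z
    linarith

lemma cx_repr {h : ℝ → ℝ} (hc : ConvexOn ℝ Set.univ h) (h0 : Tendsto h atBot (nhds 0)) :
    ∃ σ : Measure ℝ, SFinite σ ∧ (∀ t, 0 ≤ derivWithin h (Ioi t) t) ∧
      (∀ t, σ (Iic t) = ENNReal.ofReal (derivWithin h (Ioi t) t)) ∧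
      ∀ x, ∫⁻ k, ENNReal.ofReal (x - k) ∂σ = ENNReal.ofReal (h x) := by
  have hcont := cx_cont hc
  set s : ℝ → ℝ := fun x => derivWithin h (Ioi x) x with hs
  have hmono : Monotone s := cx_mono hc
  have hnn : ∀ t, 0 ≤ s t := by
    intro t
    by_contra! hneg
    have hlin : Tendsto (fun y => h t + s t * (y - t)) atBot atTop := by
      refine tendsto_atTop_add_const_left _ _ ?_
      refine Tendsto.const_mul_atBot_of_neg hneg ?_
      exact tendsto_atBot_add_const_right _ _ tendsto_id
    exact not_tendsto_nhds_of_tendsto_atTop (tendsto_atTop_mono (cx_supp hc t) hlin) _ h0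
  have hs0 : Tendsto s atBot (nhds 0) := by
    have h1 : Tendsto (fun x => h (x + 1) - h x) atBot (nhds 0) := by
      simpa using (h0.comp (tendsto_atBot_add_const_right _ 1 tendsto_id)).sub h0
    refine squeeze_zero hnn (fun x => ?_) h1
    have := cx_supp hc x (x + 1)
    simp only [hs]
    linarith
  let F : StieltjesFunction ℝ := ⟨s, hmono, cx_rcont hc⟩
  have hIic : ∀ t, F.measure (Iic t) = ENNReal.ofReal (s t) := by
    intro t
    rw [F.measure_Iic (l := 0) hs0 t, sub_zero]
  refine ⟨F.measure, inferInstance, hnn, hIic, fun x => ?_⟩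
  have e1 : ∀ k : ℝ, ENNReal.ofReal (x - k) = 
      ∫⁻ t, (Iic x).indicator (fun _ => (Iic t).indicator (fun _ => (1 : ENNReal)) k) t := by
    intro k
    have : (fun t => (Iic x).indicator (fun _ => (Iic t).indicator (fun _ => (1 : ENNReal)) k) t)
        = (Icc k x).indicator (fun _ => 1) := by
      funext t
      by_cases h1 : t ≤ x <;> by_cases h2 : k ≤ t <;> simp [indicator, h1, h2]
    rw [this, lintegral_indicator measurableSet_Icc]
    simp
  have hmeas : Measurable (fun p : ℝ × ℝ =>
      (Iic x).indicator (fun _ => (Iic p.2).indicator (fun _ => (1 : ENNReal)) p.1) p.2) := by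
    have hA : MeasurableSet {p : ℝ × ℝ | p.2 ≤ x ∧ p.1 ≤ p.2} :=
      (measurableSet_le measurable_snd measurable_const).inter
        (measurableSet_le measurable_fst measurable_snd)
    have : (fun p : ℝ × ℝ =>
      (Iic x).indicator (fun _ => (Iic p.2).indicator (fun _ => (1 : ENNReal)) p.1) p.2)
        = {p : ℝ × ℝ | p.2 ≤ x ∧ p.1 ≤ p.2}.indicator (fun _ => 1) := by
      funext p
      by_cases h1 : p.2 ≤ x <;> by_cases h2 : p.1 ≤ p.2 <;> simp [indicator, h1, h2]
    rw [this]
    exact measurable_const.indicator hA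
  simp_rw [e1]
  rw [lintegral_lintegral_swap hmeas.aemeasurable]
  have e2 : ∀ t, ∫⁻ k, (Iic x).indicator (fun _ => (Iic t).indicator (fun _ => (1 : ENNReal)) k) t
      ∂F.measure = (Iic x).indicator (fun t => ENNReal.ofReal (s t)) t := by
    intro t
    by_cases h1 : t ≤ x
    · simp only [indicator_of_mem (show t ∈ Iic x from h1)]
      rw [lintegral_indicator measurableSet_Iic]
      simp [hIic]
    · simp [indicator, h1]
  simp_rw [e2]
  rw [lintegral_indicator measurableSet_Iic]
  have hsm : Measurable (fun t => ENNReal.ofReal (s t)) := hmono.measurable.ennreal_ofReal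
  have hfin : ∀ a ≤ x, (volume.withDensity (fun t => ENNReal.ofReal (s t))) (Ioc a x)
      = ENNReal.ofReal (h x - h a) := by
    intro a ha
    have hii : IntervalIntegrable s volume a x := hmono.intervalIntegrable
    rw [withDensity_apply _ measurableSet_Ioc,
      ← intervalIntegral.integral_eq_sub_of_hasDeriv_right_of_le ha hcont.continuousOn
      (fun t _ => hc.hasDerivWithinAt_rightDeriv_of_mem_interior (x := t) (by simp)) hii,
      intervalIntegral.integral_of_le ha,
      ofReal_integral_eq_lintegral_ofReal]
    · exact (intervalIntegrable_iff_integrableOn_Ioc_of_le ha).1 hii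
    · exact Eventually.of_forall hnn
  rw [← withDensity_apply _ measurableSet_Iic]
  refine tendsto_nhds_unique (tendsto_measure_Ioc_atBot _ x) ?_
  have : Tendsto (fun a => ENNReal.ofReal (h x - h a)) atBot (nhds (ENNReal.ofReal (h x))) := by
    refine ENNReal.tendsto_ofReal ?_
    simpa using h0.const_sub (h x)
  refine this.congr' ?_
  filter_upwards [eventually_le_atBot x] with a ha
  exact (hfin a ha).symm

lemma cx_of_supp {C : ℝ → ℝ} (h : ∀ t, ∃ m, ∀ s, C t + m * (s - t) ≤ C s) :
    ConvexOn ℝ Set.univ C := by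
  refine ⟨convex_univ, fun x _ y _ a b ha hb hab => ?_⟩
  simp only [smul_eq_mul]
  obtain ⟨m, hm⟩ := h (a * x + b * y)
  have h1 := mul_le_mul_of_nonneg_left (hm x) ha
  have h2 := mul_le_mul_of_nonneg_left (hm y) hb
  obtain rfl : b = 1 - a := by linarith
  nlinarith

lemma cx_glue {A B : ℝ → ℝ} (hA : ConvexOn ℝ Set.univ A) (hB : ConvexOn ℝ Set.univ B)
    {x y : ℝ} (hx : B x ≤ A x) (hy : B y ≤ A y) :
    ConvexOn ℝ Set.univ (fun t => if t ∈ Icc x y then max (A t) (B t) else A t) := by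
  classical
  set C : ℝ → ℝ := fun t => if t ∈ Icc x y then max (A t) (B t) else A t with hC
  have hCA : ∀ t, A t ≤ C t := by
    intro t; simp only [hC]; split_ifs
    · exact le_max_left _ _
    · exact le_rfl
  refine cx_of_supp fun t => ?_
  by_cases ht : t ∈ Icc x y ∧ A t < B t
  · refine ⟨derivWithin B (Ioi t) t, fun s => ?_⟩
    have hCt : C t = B t := by simp only [hC, if_pos ht.1]; exact max_eq_right ht.2.le
    rw [hCt]
    set m := derivWithin B (Ioi t) t
    have hsB : ∀ s, B t + m * (s - t) ≤ B s := cx_supp hB t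
    by_cases hs : s ∈ Icc x y
    · refine (hsB s).trans ?_
      simp only [hC, if_pos hs]; exact le_max_right _ _
    · refine le_trans ?_ (hCA s)
      have key : ∀ r, B r ≤ A r → (t < r ∧ r < s ∨ s < r ∧ r < t) → B t + m * (s - t) ≤ A s := by
        intro r hr hrs
        have h1 := hsB r
        have h2 := cx_supp hA r s
        have h3 := cx_supp hA r t
        set k := derivWithin A (Ioi r) r
        have h4 : B t + m * (r - t) ≤ A r := h1.trans hr
        have h5 : A t < B t := ht.2
        rcases hrs with ⟨h6, h7⟩ | ⟨h6, h7⟩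
        · have : m ≤ k := by
            by_contra! hcon
            nlinarith
          nlinarith
        · have : k ≤ m := by
            by_contra! hcon
            nlinarith
          nlinarith
      have hxt : x ≠ t := by rintro rfl; linarith [ht.2]
      have hyt : y ≠ t := by rintro rfl; linarith [ht.2]
      have hxt' := lt_of_le_of_ne ht.1.1 hxt
      have hyt' := lt_of_le_of_ne ht.1.2 hyt.symm
      rcases lt_or_ge s x with h | h
      · exact key x hx (Or.inr ⟨h, hxt'⟩)
      · have : y < s := by
          by_contra! hcon
          exact hs ⟨h, hcon⟩
        exact key y hy (Or.inl ⟨hyt', this⟩)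
  · refine ⟨derivWithin A (Ioi t) t, fun s => ?_⟩
    have hCt : C t = A t := by
      simp only [hC]; split_ifs with h
      · exact max_eq_left (not_lt.1 fun h' => ht ⟨h, h'⟩)
      · rfl
    rw [hCt]
    exact (cx_supp hA t s).trans (hCA s)

lemma cx_affine (a b : ℝ) : ConvexOn ℝ Set.univ (fun t => a * t + b) := by
  refine cx_of_supp fun t => ⟨a, fun s => ?_⟩
  linarith

lemma hull_exists {Q g : ℝ → ℝ} (hg : ConvexOn ℝ Set.univ g) (hgQ : ∀ x, g x ≤ Q x) :
    ∃ H, IsConvexHull Q H := by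
  let T := {g : ℝ → ℝ // ConvexOn ℝ Set.univ g ∧ ∀ x, g x ≤ Q x}
  have : Nonempty T := ⟨⟨g, hg, hgQ⟩⟩
  have hbdd : ∀ x, BddAbove (Set.range fun g : T => g.1 x) := by
    intro x
    refine ⟨Q x, ?_⟩
    rintro _ ⟨g, rfl⟩
    exact g.2.2 x
  refine ⟨fun x => ⨆ g : T, g.1 x, ⟨convex_univ, fun x _ y _ a b ha hb hab => ?_⟩,
    fun x => ciSup_le fun g => g.2.2 x, fun g hg hgQ x => ?_⟩
  · refine ciSup_le fun g => ?_
    refine (g.2.1.2 (mem_univ x) (mem_univ y) ha hb hab).trans ?_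
    simp only [smul_eq_mul]
    exact add_le_add (mul_le_mul_of_nonneg_left (le_ciSup (hbdd x) g) ha)
      (mul_le_mul_of_nonneg_left (le_ciSup (hbdd y) g) hb)
  · exact le_ciSup (hbdd x) (⟨g, hg, hgQ⟩ : T)

lemma hull_diff {F G H : ℝ → ℝ} (hF : ConvexOn ℝ Set.univ F) (hG : ConvexOn ℝ Set.univ G)
    (hH : IsConvexHull (fun x => F x - G x) H) : ConvexOn ℝ Set.univ (fun x => F x - H x) := by
  obtain ⟨hH1, hH2, hH3⟩ := hH
  have main : ∀ x y : ℝ, x < y → ∀ t ∈ Icc x y, (F t - H t) ≤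
      (F x - H x) + ((F y - H y) - (F x - H x)) / (y - x) * (t - x) := by
    intro x y hxy t ht
    set m := ((F y - H y) - (F x - H x)) / (y - x) with hm
    have hm' : m * (y - x) = (F y - H y) - (F x - H x) := by
      rw [hm]; field_simp [(sub_pos.2 hxy).ne']
    have hB : ConvexOn ℝ Set.univ (fun t => F t + (-m * t + (m * x - (F x - H x)))) :=
      hF.add (cx_affine _ _)
    have hgl := cx_glue hH1 hB (x := x) (y := y) (by simp; linarith) (by simp; linarith)
    have := hH3 _ hgl ?_ t
    · rw [if_pos ht] at this
      have := (le_max_right _ _).trans this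
      simp at this
      linarith
    · intro r
      split_ifs with hr
      · refine max_le (hH2 r) ?_
        have hGr : G r ≤ (F x - H x) + m * (r - x) := by
          have h1 := cx_supp hG r x
          have h2 := cx_supp hG r y
          have h3 := hH2 x
          have h4 := hH2 y
          simp at h3 h4
          set k := derivWithin G (Ioi r) r
          have h5 : 0 ≤ r - x := by linarith [hr.1]
          have h6 : 0 ≤ y - r := by linarith [hr.2]
          have h7 : (G r + k * (x - r)) * (y - r) ≤ (F x - H x) * (y - r) :=
            mul_le_mul_of_nonneg_right (by linarith) h6
          have h8 : (G r + k * (y - r)) * (r - x) ≤ (F x - H x + m * (y - x)) * (r - x) :=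
            mul_le_mul_of_nonneg_right (by linarith) h5
          have h9 : G r * (y - x) ≤ ((F x - H x) + m * (r - x)) * (y - x) := by nlinarith
          exact le_of_mul_le_mul_right h9 (by linarith)
        simp only
        linarith
      · exact hH2 r
  refine LinearOrder.convexOn_of_lt convex_univ ?_
  intro x _ y _ hxy a b ha hb hab
  have := main x y hxy (a • x + b • y) ⟨?_, ?_⟩
  · refine this.trans (le_of_eq ?_)
    simp only [smul_eq_mul]
    have : (y - x) ≠ 0 := by linarith
    obtain rfl : a = 1 - b := by linarith
    field_simp
    ring
  · simp only [smul_eq_mul]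
    obtain rfl : a = 1 - b := by linarith
    nlinarith
  · simp only [smul_eq_mul]
    obtain rfl : b = 1 - a := by linarith
    nlinarith

lemma ecx_up {mu rho : Measure ℝ} [SFinite mu] [SFinite rho]
    (hcall : ∀ k, ∫⁻ x, ENNReal.ofReal (x - k) ∂mu ≤ ∫⁻ x, ENNReal.ofReal (x - k) ∂rho)
    {h : ℝ → ℝ} (hc : ConvexOn ℝ Set.univ h) (h0 : Tendsto h atBot (nhds 0)) :
    ∫⁻ x, ENNReal.ofReal (h x) ∂mu ≤ ∫⁻ x, ENNReal.ofReal (h x) ∂rho := by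
  obtain ⟨σ, hσ, -, -, hrep⟩ := cx_repr hc h0
  simp_rw [← hrep]
  have hm : Measurable (fun p : ℝ × ℝ => ENNReal.ofReal (p.1 - p.2)) := by fun_prop
  rw [lintegral_lintegral_swap (μ := mu) hm.aemeasurable,
    lintegral_lintegral_swap (μ := rho) hm.aemeasurable]
  exact lintegral_mono fun k => hcall k

lemma cx_neg {h : ℝ → ℝ} (hc : ConvexOn ℝ Set.univ h) :
    ConvexOn ℝ Set.univ (fun x => h (-x)) := by
  refine ⟨convex_univ, fun x _ y _ a b ha hb hab => ?_⟩
  have := hc.2 (mem_univ (-x)) (mem_univ (-y)) ha hb hab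
  simp only [smul_eq_mul] at this ⊢
  convert this using 2
  ring

lemma ecx_down {mu rho : Measure ℝ} [SFinite mu] [SFinite rho]
    (hput : ∀ k, ∫⁻ x, ENNReal.ofReal (k - x) ∂mu ≤ ∫⁻ x, ENNReal.ofReal (k - x) ∂rho)
    {h : ℝ → ℝ} (hc : ConvexOn ℝ Set.univ h) (h0 : Tendsto h atTop (nhds 0)) :
    ∫⁻ x, ENNReal.ofReal (h x) ∂mu ≤ ∫⁻ x, ENNReal.ofReal (h x) ∂rho := by
  obtain ⟨σ, hσ, -, -, hrep⟩ := cx_repr (cx_neg hc) (h0.comp tendsto_neg_atBot_atTop)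
  have hrep' : ∀ x, ENNReal.ofReal (h x) = ∫⁻ k, ENNReal.ofReal (-x - k) ∂σ := by
    intro x
    have := hrep (-x)
    rw [neg_neg] at this
    exact this.symm
  simp_rw [hrep']
  have hm : Measurable (fun p : ℝ × ℝ => ENNReal.ofReal (-p.1 - p.2)) := by fun_prop
  rw [lintegral_lintegral_swap (μ := mu) hm.aemeasurable,
    lintegral_lintegral_swap (μ := rho) hm.aemeasurable]
  refine lintegral_mono fun k => ?_
  have := hput (-k)
  have e : ∀ x : ℝ, -k - x = -x - k := fun x => by ring
  simp_rw [e] at this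
  exact this

/-- Largest nondecreasing minorant. -/
noncomputable def upf (f : ℝ → ℝ) (x : ℝ) : ℝ := ⨅ y : {y : ℝ // 0 ≤ y}, f (x + y.1)

lemma upf_le {f : ℝ → ℝ} (h0 : ∀ x, 0 ≤ f x) {x z : ℝ} (hz : x ≤ z) : upf f x ≤ f z := by
  have hb : BddBelow (Set.range fun y : {y : ℝ // 0 ≤ y} => f (x + y.1)) :=
    ⟨0, by rintro _ ⟨y, rfl⟩; exact h0 _⟩
  have := ciInf_le hb ⟨z - x, by linarith⟩
  rw [add_sub_cancel] at this
  exact this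

lemma le_upf {f : ℝ → ℝ} {x c : ℝ} (h : ∀ z, x ≤ z → c ≤ f z) : c ≤ upf f x := by
  have : Nonempty {y : ℝ // 0 ≤ y} := ⟨⟨0, le_rfl⟩⟩
  exact le_ciInf fun y => h _ (by linarith [y.2])

lemma upf_lt {f : ℝ → ℝ} {x c : ℝ} (h : upf f x < c) : ∃ z, x ≤ z ∧ f z < c := by
  by_contra! hcon
  exact absurd (le_upf hcon) (not_le.2 h)

lemma upf_convex {f : ℝ → ℝ} (hc : ConvexOn ℝ Set.univ f) (h0 : ∀ x, 0 ≤ f x) :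
    ConvexOn ℝ Set.univ (upf f) := by
  refine ⟨convex_univ, fun x _ y _ a b ha hb hab => ?_⟩
  refine le_of_forall_pos_le_add fun ε hε => ?_
  obtain ⟨z, hz, hz'⟩ := upf_lt (f := f) (x := x) (c := upf f x + ε) (by linarith)
  obtain ⟨w, hw, hw'⟩ := upf_lt (f := f) (x := y) (c := upf f y + ε) (by linarith)
  have h1 : upf f (a • x + b • y) ≤ f (a • z + b • w) := by
    refine upf_le h0 ?_
    simp only [smul_eq_mul]
    nlinarith
  have h2 := hc.2 (mem_univ z) (mem_univ w) ha hb hab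
  simp only [smul_eq_mul] at *
  obtain rfl : b = 1 - a := by linarith
  nlinarith

lemma upf_tendsto {f : ℝ → ℝ} (h0 : ∀ x, 0 ≤ f x) :
    Tendsto (fun x => upf f x - ⨅ y, f y) atBot (nhds 0) := by
  have hb : BddBelow (Set.range f) := ⟨0, by rintro _ ⟨y, rfl⟩; exact h0 _⟩
  refine tendsto_order.2 ⟨fun a ha => ?_, fun b hb => ?_⟩
  · refine Eventually.of_forall fun x => ?_
    have := le_upf (f := f) (x := x) fun z _ => ciInf_le hb z
    linarith
  · obtain ⟨z, hz⟩ := exists_lt_of_ciInf_lt (f := f) (a := (⨅ y, f y) + b) (by linarith)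
    filter_upwards [eventually_le_atBot z] with x hx
    have := upf_le h0 hx
    linarith

lemma upf_decomp {f : ℝ → ℝ} (hc : ConvexOn ℝ Set.univ f) (h0 : ∀ x, 0 ≤ f x) (x : ℝ) :
    f x = upf f x + upf (fun y => f (-y)) (-x) - ⨅ y, f y := by
  have hb : BddBelow (Set.range f) := ⟨0, by rintro _ ⟨y, rfl⟩; exact h0 _⟩
  have h0' : ∀ x, 0 ≤ f (-x) := fun x => h0 _
  set c := ⨅ y, f y with hcdef
  have hcu : c ≤ upf f x := le_upf fun z _ => ciInf_le hb z
  have hcd : c ≤ upf (fun y => f (-y)) (-x) := le_upf fun z _ => ciInf_le hb (-z)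
  by_cases h : ∃ y, x ≤ y ∧ f y < f x
  · obtain ⟨y, hy, hfy⟩ := h
    have hxy : x < y := lt_of_le_of_ne hy (by rintro rfl; linarith)
    have hge : ∀ z, z ≤ x → f x ≤ f z := by
      intro z hz
      by_contra! hlt
      have hzx : z < x := lt_of_le_of_ne hz (by rintro rfl; linarith)
      have := hc.le_max_of_mem_Icc (mem_univ z) (mem_univ y) (z := x) ⟨hz, hy⟩
      rcases le_max_iff.1 this with h | h <;> linarith
    have e1 : upf (fun y => f (-y)) (-x) = f x := by
      apply le_antisymm
      · simpa using upf_le (f := fun y => f (-y)) h0' (le_refl (-x))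
      · exact le_upf fun z hz => hge _ (by linarith)
    have e2 : upf f x = c := by
      refine le_antisymm (le_ciInf fun z => ?_) hcu
      rcases le_total x z with hz | hz
      · exact upf_le h0 hz
      · exact (upf_le h0 le_rfl).trans (hge z hz)
    rw [e1, e2]; ring
  · push Not at h
    have e1 : upf f x = f x := le_antisymm (upf_le h0 le_rfl) (le_upf h)
    have e2 : upf (fun y => f (-y)) (-x) = c := by
      refine le_antisymm (le_ciInf fun z => ?_) hcd
      rcases le_total x z with hz | hz
      · refine le_trans ?_ (h z hz)
        simpa using upf_le (f := fun y => f (-y)) h0' (le_refl (-x))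
      · simpa using upf_le (f := fun y => f (-y)) h0' (neg_le_neg hz)
    rw [e1, e2]; ring

lemma ecx_of_pot {mu rho : Measure ℝ} [SFinite mu] [SFinite rho]
    (hmass : mu univ ≤ rho univ)
    (hput : ∀ k, ∫⁻ x, ENNReal.ofReal (k - x) ∂mu ≤ ∫⁻ x, ENNReal.ofReal (k - x) ∂rho)
    (hcall : ∀ k, ∫⁻ x, ENNReal.ofReal (x - k) ∂mu ≤ ∫⁻ x, ENNReal.ofReal (x - k) ∂rho) :
    ECx mu rho := by
  intro f hc h0
  have hb : BddBelow (Set.range f) := ⟨0, by rintro _ ⟨y, rfl⟩; exact h0 _⟩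
  have h0' : ∀ x, 0 ≤ f (-x) := fun x => h0 _
  set c := ⨅ y, f y with hcdef
  have hc0 : 0 ≤ c := le_ciInf h0
  have hinf : ⨅ y, f (-y) = c := (Equiv.neg ℝ).iInf_comp (g := f)
  set u : ℝ → ℝ := fun x => upf f x - c with hu
  set d : ℝ → ℝ := fun x => upf (fun y => f (-y)) (-x) - c with hd
  have hun : ∀ x, 0 ≤ u x := fun x => sub_nonneg.2 (le_upf fun z _ => ciInf_le hb z)
  have hdn : ∀ x, 0 ≤ d x := fun x => sub_nonneg.2 (le_upf fun z _ => ciInf_le hb (-z))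
  have huc : ConvexOn ℝ Set.univ u := by
    have := (upf_convex hc h0).add (convexOn_const (-c) convex_univ)
    exact this
  have hdc : ConvexOn ℝ Set.univ d := by
    have := cx_neg (upf_convex (cx_neg hc) h0')
    have := this.add (convexOn_const (-c) convex_univ)
    exact this
  have hut : Tendsto u atBot (nhds 0) := upf_tendsto h0
  have hdt : Tendsto d atTop (nhds 0) := by
    have := upf_tendsto h0'
    rw [hinf] at this
    exact this.comp tendsto_neg_atTop_atBot
  have hdec : ∀ x, ENNReal.ofReal (f x) =
      ENNReal.ofReal c + (ENNReal.ofReal (u x) + ENNReal.ofReal (d x)) := by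
    intro x
    rw [← ENNReal.ofReal_add (hun x) (hdn x), ← ENNReal.ofReal_add hc0 (add_nonneg (hun x) (hdn x)),
      upf_decomp hc h0 x]
    congr 1
    simp only [hu, hd]; ring
  have hum : Measurable fun x => ENNReal.ofReal (u x) := (cx_cont huc).measurable.ennreal_ofReal
  simp_rw [hdec]
  rw [lintegral_add_left measurable_const, lintegral_add_left measurable_const,
    lintegral_add_left hum, lintegral_add_left hum, lintegral_const, lintegral_const]
  exact add_le_add (mul_le_mul_right hmass _)
    (add_le_add (ecx_up hcall huc hut) (ecx_down hput hdc hdt))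

lemma cx_call (k : ℝ) : ConvexOn ℝ Set.univ (fun x : ℝ => max (x - k) 0) := by
  have := (cx_affine 1 (-k)).sup (cx_affine 0 0)
  refine this.congr fun x _ => ?_
  simp [sub_eq_add_neg]

lemma cx_put (k : ℝ) : ConvexOn ℝ Set.univ (fun x : ℝ => max (k - x) 0) := by
  have := cx_neg (cx_call (-k))
  refine this.congr fun x _ => ?_
  simp only
  congr 1; ring

lemma int_put {eta : Measure ℝ} [IsFiniteMeasure eta] (hi : Integrable (fun x => x) eta)
    (k : ℝ) : Integrable (fun x => max (k - x) 0) eta :=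
  ((integrable_const k).sub hi).pos_part

lemma int_call {eta : Measure ℝ} [IsFiniteMeasure eta] (hi : Integrable (fun x => x) eta)
    (k : ℝ) : Integrable (fun x => max (x - k) 0) eta :=
  (hi.sub (integrable_const k)).pos_part

lemma pot_nonneg (eta : Measure ℝ) (k : ℝ) : 0 ≤ pot eta k :=
  integral_nonneg fun _ => le_max_right _ _

lemma cpot_nonneg (eta : Measure ℝ) (k : ℝ) : 0 ≤ cpot eta k :=
  integral_nonneg fun _ => le_max_right _ _

lemma ofReal_max_zero (r : ℝ) : ENNReal.ofReal (max r 0) = ENNReal.ofReal r := by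
  rcases le_total r 0 with h | h
  · simp [h]
  · simp [h]

lemma lint_put {eta : Measure ℝ} [IsFiniteMeasure eta] (hi : Integrable (fun x => x) eta)
    (k : ℝ) : ∫⁻ x, ENNReal.ofReal (k - x) ∂eta = ENNReal.ofReal (pot eta k) := by
  rw [pot, ofReal_integral_eq_lintegral_ofReal (int_put hi k)
    (Eventually.of_forall fun _ => le_max_right _ _)]
  simp_rw [ofReal_max_zero]

lemma lint_call {eta : Measure ℝ} [IsFiniteMeasure eta] (hi : Integrable (fun x => x) eta)
    (k : ℝ) : ∫⁻ x, ENNReal.ofReal (x - k) ∂eta = ENNReal.ofReal (cpot eta k) := by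
  rw [cpot, ofReal_integral_eq_lintegral_ofReal (int_call hi k)
    (Eventually.of_forall fun _ => le_max_right _ _)]
  simp_rw [ofReal_max_zero]

lemma put_call {eta : Measure ℝ} [IsFiniteMeasure eta] (hi : Integrable (fun x => x) eta)
    (k : ℝ) : pot eta k - cpot eta k = eta.real univ * k - ∫ x, x ∂eta := by
  rw [pot, cpot, ← integral_sub (int_put hi k) (int_call hi k)]
  have : ∀ x : ℝ, max (k - x) 0 - max (x - k) 0 = k - x := by
    intro x
    rcases le_total x k with h | h
    · rw [max_eq_left (by linarith), max_eq_right (by linarith)]; ring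
    · rw [max_eq_right (by linarith), max_eq_left (by linarith)]; ring
  simp_rw [this]
  rw [integral_sub (integrable_const k) hi, integral_const]
  simp

lemma pot_convex {eta : Measure ℝ} [IsFiniteMeasure eta] (hi : Integrable (fun x => x) eta) :
    ConvexOn ℝ Set.univ (pot eta) := by
  refine ⟨convex_univ, fun x _ y _ a b ha hb hab => ?_⟩
  simp only [pot, smul_eq_mul]
  rw [← integral_const_mul, ← integral_const_mul,
    ← integral_add ((int_put hi x).const_mul a) ((int_put hi y).const_mul b)]
  refine integral_mono (int_put hi _)
    (((int_put hi x).const_mul a).add ((int_put hi y).const_mul b)) fun z => ?_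
  simpa using (cx_call z).2 (mem_univ x) (mem_univ y) ha hb hab

lemma cpot_convex {eta : Measure ℝ} [IsFiniteMeasure eta] (hi : Integrable (fun x => x) eta) :
    ConvexOn ℝ Set.univ (cpot eta) := by
  refine ((pot_convex hi).add (cx_affine (-eta.real univ) (∫ x, x ∂eta))).congr fun k _ => ?_
  have := put_call hi k
  simp only [Pi.add_apply]
  linarith

lemma pot_tendsto {eta : Measure ℝ} [IsFiniteMeasure eta] (hi : Integrable (fun x => x) eta) :
    Tendsto (pot eta) atBot (nhds 0) := by
  have h := tendsto_integral_filter_of_dominated_convergence (μ := eta) (l := atBot)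
    (F := fun k x : ℝ => max (k - x) 0) (f := fun _ => 0) (fun x => |x|)
    (Eventually.of_forall fun k => (int_put hi k).aestronglyMeasurable)
    (by
      filter_upwards [eventually_le_atBot 0] with k hk
      refine Eventually.of_forall fun x => ?_
      rw [Real.norm_of_nonneg (le_max_right _ _)]
      exact max_le (by linarith [neg_abs_le x]) (abs_nonneg x))
    hi.abs
    (Eventually.of_forall fun x => by
      refine tendsto_const_nhds.congr' ?_
      filter_upwards [eventually_le_atBot x] with k hk
      rw [max_eq_right (by linarith)])
  rw [integral_zero] at h
  exact h

lemma cpot_tendsto {eta : Measure ℝ} [IsFiniteMeasure eta] (hi : Integrable (fun x => x) eta) :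
    Tendsto (cpot eta) atTop (nhds 0) := by
  have h := tendsto_integral_filter_of_dominated_convergence (μ := eta) (l := atTop)
    (F := fun k x : ℝ => max (x - k) 0) (f := fun _ => 0) (fun x => |x|)
    (Eventually.of_forall fun k => (int_call hi k).aestronglyMeasurable)
    (by
      filter_upwards [eventually_ge_atTop 0] with k hk
      refine Eventually.of_forall fun x => ?_
      rw [Real.norm_of_nonneg (le_max_right _ _)]
      exact max_le (by linarith [le_abs_self x]) (abs_nonneg x))
    hi.abs
    (Eventually.of_forall fun x => by
      refine tendsto_const_nhds.congr' ?_
      filter_upwards [eventually_ge_atTop x] with k hk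
      rw [max_eq_right (by linarith)])
  rw [integral_zero] at h
  exact h

lemma pot_deriv {eta : Measure ℝ} [IsFiniteMeasure eta] (hi : Integrable (fun x => x) eta)
    (t : ℝ) : HasDerivWithinAt (pot eta) (eta.real (Iic t)) (Ioi t) t := by
  rw [hasDerivWithinAt_iff_tendsto_slope' (by simp)]
  have hsl : ∀ y, slope (pot eta) t y =
      ∫ x, (max (y - x) 0 - max (t - x) 0) / (y - t) ∂eta := by
    intro y
    rw [slope_def_field, integral_div, integral_sub (int_put hi y) (int_put hi t)]
    rfl
  have hlim : eta.real (Iic t) = ∫ x, (Iic t).indicator (fun _ => (1 : ℝ)) x ∂eta := by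
    rw [integral_indicator measurableSet_Iic]; simp
  have hfun : slope (pot eta) t =
      fun y => ∫ x, (max (y - x) 0 - max (t - x) 0) / (y - t) ∂eta := funext hsl
  rw [hfun, hlim]
  refine tendsto_integral_filter_of_dominated_convergence (fun _ => (1 : ℝ)) ?_ ?_
    (integrable_const _) ?_
  · exact Eventually.of_forall fun y =>
      (((int_put hi y).sub (int_put hi t)).div_const _).aestronglyMeasurable
  · filter_upwards [self_mem_nhdsWithin] with y hy
    have hy : t < y := hy
    refine Eventually.of_forall fun x => ?_
    have hpos : 0 < y - t := by linarith
    have h1 : max (t - x) 0 ≤ max (y - x) 0 := max_le_max (by linarith) le_rfl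
    have h2 : max (y - x) 0 ≤ max (t - x) 0 + (y - t) :=
      max_le (by linarith [le_max_left (t - x) 0]) (by linarith [le_max_right (t - x) 0])
    rw [Real.norm_of_nonneg (div_nonneg (by linarith) hpos.le), div_le_one hpos]
    linarith
  · refine Eventually.of_forall fun x => ?_
    refine tendsto_const_nhds.congr' ?_
    by_cases hx : x ≤ t
    · filter_upwards [self_mem_nhdsWithin] with y hy
      have hy : t < y := hy
      rw [indicator_of_mem (show x ∈ Iic t from hx), max_eq_left (by linarith),
        max_eq_left (by linarith)]
      rw [show y - x - (t - x) = y - t by ring, div_self (by linarith)]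
    · have hx' : t < x := not_le.1 hx
      filter_upwards [nhdsWithin_le_nhds (gt_mem_nhds hx')] with y hy
      rw [indicator_of_notMem (show x ∉ Iic t from hx), max_eq_right (by linarith),
        max_eq_right (by linarith)]
      simp

lemma affine_zero {a b : ℝ} (h : Tendsto (fun k : ℝ => a * k + b) atTop (nhds 0)) :
    a = 0 ∧ b = 0 := by
  have h1 := (h.comp (tendsto_atTop_add_const_right atTop (1 : ℝ) tendsto_id)).sub h
  have h2 : Tendsto (fun _ : ℝ => a) atTop (nhds 0) := by
    have : (fun k : ℝ => ((fun k : ℝ => a * k + b) ∘ fun k => id k + 1) k - (a * k + b))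
        = fun _ => a := by
      funext k; simp; ring
    rw [this] at h1
    simpa using h1
  have ha : a = 0 := tendsto_nhds_unique tendsto_const_nhds h2
  subst ha
  refine ⟨rfl, ?_⟩
  simp only [zero_mul, zero_add] at h
  exact tendsto_nhds_unique tendsto_const_nhds h

lemma cx_of_ecx {mu eta : Measure ℝ} [IsFiniteMeasure mu] [IsFiniteMeasure eta]
    (h1 : Integrable (fun x => x) mu) (h2 : Integrable (fun x => x) eta)
    (hE : ECx mu eta) (hm : mu.real univ = eta.real univ)
    (hb : ∫ x, x ∂mu = ∫ x, x ∂eta) : Cx mu eta := by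
  intro f hf hf1 hf2
  set s := derivWithin f (Ioi 0) 0 with hs
  have hg : ConvexOn ℝ Set.univ (fun x => f x + (-s * x + -f 0)) := hf.add (cx_affine _ _)
  have hg0 : ∀ x, 0 ≤ f x + (-s * x + -f 0) := by
    intro x
    have := cx_supp hf 0 x
    rw [← hs] at this
    linarith
  have a1 : Integrable (fun x => -s * x + -f 0) mu := (h1.const_mul _).add (integrable_const _)
  have a2 : Integrable (fun x => -s * x + -f 0) eta := (h2.const_mul _).add (integrable_const _)
  have := hE _ hg hg0
  have b1 : Integrable (fun x => f x + (-s * x + -f 0)) mu := hf1.add a1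
  have b2 : Integrable (fun x => f x + (-s * x + -f 0)) eta := hf2.add a2
  rw [← ofReal_integral_eq_lintegral_ofReal b1 (Eventually.of_forall hg0),
    ← ofReal_integral_eq_lintegral_ofReal b2 (Eventually.of_forall hg0),
    ENNReal.ofReal_le_ofReal_iff (integral_nonneg hg0)] at this
  rw [integral_add hf1 a1, integral_add hf2 a2,
    integral_add (h1.const_mul _) (integrable_const _),
    integral_add (h2.const_mul _) (integrable_const _), integral_const_mul, integral_const_mul,
    integral_const, integral_const, hm, hb] at this
  linarith

lemma pot_add {eta kap : Measure ℝ} [IsFiniteMeasure eta] [IsFiniteMeasure kap]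
    (h1 : Integrable (fun x => x) eta) (h2 : Integrable (fun x => x) kap) (k : ℝ) :
    pot (eta + kap) k = pot eta k + pot kap k :=
  integral_add_measure (int_put h1 k) (int_put h2 k)

lemma cpot_add {eta kap : Measure ℝ} [IsFiniteMeasure eta] [IsFiniteMeasure kap]
    (h1 : Integrable (fun x => x) eta) (h2 : Integrable (fun x => x) kap) (k : ℝ) :
    cpot (eta + kap) k = cpot eta k + cpot kap k :=
  integral_add_measure (int_call h1 k) (int_call h2 k)

theorem stmt16 (mu1 mu2 nu : Measure ℝ)
    [IsFiniteMeasure mu1] [IsFiniteMeasure mu2] [IsFiniteMeasure nu]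
    (hint1 : Integrable (fun x => x) mu1) (hint2 : Integrable (fun x => x) mu2)
    (hintn : Integrable (fun x => x) nu)
    (hE : ECx (mu1 + mu2) nu)
    (S : Measure ℝ) (hS : IsShadow mu1 nu S) :
    ECx mu2 (nu - S) := by
  have hint12 : Integrable (fun x => x) (mu1 + mu2) := hint1.add_measure hint2
  -- consequences of the hypothesis for puts, calls and constants
  have hput : ∀ k, pot mu1 k + pot mu2 k ≤ pot nu k := by
    intro k
    have := hE _ (cx_put k) fun _ => le_max_right _ _
    simp_rw [ofReal_max_zero] at this
    rwa [lint_put hint12, lint_put hintn, ENNReal.ofReal_le_ofReal_iff (pot_nonneg _ _),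
      pot_add hint1 hint2] at this
  have hcall : ∀ k, cpot mu1 k + cpot mu2 k ≤ cpot nu k := by
    intro k
    have := hE _ (cx_call k) fun _ => le_max_right _ _
    simp_rw [ofReal_max_zero] at this
    rwa [lint_call hint12, lint_call hintn, ENNReal.ofReal_le_ofReal_iff (cpot_nonneg _ _),
      cpot_add hint1 hint2] at this
  have hmass : mu1 univ + mu2 univ ≤ nu univ := by
    have := hE _ (convexOn_const 1 convex_univ) fun _ => zero_le_one
    simpa using this
  have hpc1 := put_call hint1
  have hpc2 := put_call hint2
  have hpcn := put_call hintn
  -- the convex hull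
  obtain ⟨H, hH⟩ := hull_exists (Q := fun k => pot nu k - pot mu1 k) (pot_convex hint2)
    (fun k => by have := hput k; linarith)
  have hUc : ConvexOn ℝ Set.univ (fun k => pot nu k - H k) :=
    hull_diff (pot_convex hintn) (pot_convex hint1) hH
  obtain ⟨hHc, hHle, hHmax⟩ := hH
  simp only at hHle
  have hH2 : ∀ k, pot mu2 k ≤ H k :=
    hHmax _ (pot_convex hint2) (fun k => by have := hput k; linarith)
  have hHL : ∀ k, cpot mu2 k + ((nu.real univ - mu1.real univ) * k
      + -(∫ x, x ∂nu - ∫ x, x ∂mu1)) ≤ H k := by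
    refine hHmax _ ((cpot_convex hint2).add (cx_affine _ _)) fun k => ?_
    have h1 := hcall k
    have h2 := hpc1 k
    have h3 := hpcn k
    simp only [Pi.add_apply]
    linarith
  have hH0 : ∀ k, 0 ≤ H k := fun k => (pot_nonneg _ _).trans (hH2 k)
  have hU1 : ∀ k, pot mu1 k ≤ pot nu k - H k := fun k => by linarith [hHle k]
  have hU0 : ∀ k, 0 ≤ pot nu k - H k := fun k => (pot_nonneg _ _).trans (hU1 k)
  have hHt : Tendsto H atBot (nhds 0) :=
    squeeze_zero hH0 (fun k => by linarith [hU0 k]) (pot_tendsto hintn)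
  have hUt : Tendsto (fun k => pot nu k - H k) atBot (nhds 0) :=
    squeeze_zero hU0 (fun k => by linarith [hH0 k]) (pot_tendsto hintn)
  obtain ⟨eta, -, hUd, hetaI, hetaP⟩ := cx_repr hUc hUt
  obtain ⟨kap, -, hHd, hkapI, -⟩ := cx_repr hHc hHt
  have hsum : nu = eta + kap := by
    refine Measure.ext_of_Iic _ _ fun t => ?_
    rw [Measure.add_apply, hetaI, hkapI, ← ENNReal.ofReal_add (hUd t) (hHd t)]
    have d1 := (hUc.hasDerivWithinAt_rightDeriv_of_mem_interior (x := t) (by simp)).add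
      (hHc.hasDerivWithinAt_rightDeriv_of_mem_interior (x := t) (by simp))
    have e : (fun k => pot nu k - H k) + H = pot nu := by funext k; simp
    rw [e] at d1
    have d2 := pot_deriv hintn t
    have u := uniqueDiffWithinAt_Ioi t
    rw [← d1.derivWithin u, d2.derivWithin u]
    simp
  have hle : eta ≤ nu := by rw [hsum]; exact Measure.le_add_right le_rfl
  have : IsFiniteMeasure eta := isFiniteMeasure_of_le nu hle
  have hinte : Integrable (fun x => x) eta := hintn.mono_measure hle
  have hpe : ∀ k, pot eta k = pot nu k - H k := by
    intro k
    have := hetaP k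
    rwa [lint_put hinte, ENNReal.ofReal_eq_ofReal_iff (pot_nonneg _ _) (hU0 k)] at this
  have hpce := put_call hinte
  -- mass and mean of eta
  have hlimU : Tendsto (fun k => pot eta k - pot mu1 k) atTop (nhds 0) := by
    refine squeeze_zero (fun k => ?_) (fun k => ?_) (cpot_tendsto hintn)
    · rw [hpe]; linarith [hU1 k]
    · rw [hpe]
      have h1 := hHL k
      have h2 := cpot_nonneg mu2 k
      have h3 := hpcn k
      have h4 := hpc1 k
      have h5 := cpot_nonneg mu1 k
      linarith
  have haff : Tendsto (fun k : ℝ => (eta.real univ - mu1.real univ) * k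
      + -(∫ x, x ∂eta - ∫ x, x ∂mu1)) atTop (nhds 0) := by
    have h := (hlimU.sub (cpot_tendsto hinte)).add (cpot_tendsto hint1)
    simp only [sub_zero, add_zero] at h
    refine h.congr fun k => ?_
    have h1 := hpce k
    have h2 := hpc1 k
    linarith
  obtain ⟨hme, hbe⟩ := affine_zero haff
  have hme' : eta.real univ = mu1.real univ := by linarith
  have hbe' : ∫ x, x ∂eta = ∫ x, x ∂mu1 := by linarith
  have hcxe : Cx mu1 eta := by
    refine cx_of_ecx hint1 hinte (ecx_of_pot ?_ ?_ ?_) hme'.symm hbe'.symm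
    · exact le_of_eq ((measureReal_eq_measureReal_iff (measure_ne_top _ _)
        (measure_ne_top _ _)).1 hme'.symm)
    · intro k
      rw [lint_put hint1, lint_put hinte]
      refine ENNReal.ofReal_le_ofReal ?_
      rw [hpe]; exact hU1 k
    · intro k
      rw [lint_call hint1, lint_call hinte]
      refine ENNReal.ofReal_le_ofReal ?_
      have h1 := hpce k
      have h2 := hpc1 k
      have h3 := hU1 k
      rw [hpe] at h1
      rw [hme', hbe'] at h1
      linarith
  -- use minimality of the shadow
  obtain ⟨hS1, hS2, hS3⟩ := hS
  have hSe := hS3 eta hcxe hle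
  have : IsFiniteMeasure S := isFiniteMeasure_of_le nu hS2
  have hintS : Integrable (fun x => x) S := hintn.mono_measure hS2
  have hSput : ∀ k, pot S k ≤ pot eta k := fun k =>
    hSe _ (cx_put k) (int_put hintS k) (int_put hinte k)
  have hScall : ∀ k, cpot S k ≤ cpot eta k := fun k =>
    hSe _ (cx_call k) (int_call hintS k) (int_call hinte k)
  have hSm : S.real univ = mu1.real univ := by
    have h1 := hS1 _ (convexOn_const (1 : ℝ) convex_univ) (integrable_const _) (integrable_const _)
    have h2 := hS1 _ (convexOn_const (-1 : ℝ) convex_univ) (integrable_const _) (integrable_const _)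
    simp at h1 h2
    linarith
  have htau : nu - S + S = nu := Measure.sub_add_cancel_of_le hS2
  have htle : nu - S ≤ nu := Measure.sub_le
  have hintt : Integrable (fun x => x) (nu - S) := hintn.mono_measure htle
  have hpt : ∀ k, pot (nu - S) k + pot S k = pot nu k := fun k => by
    rw [← pot_add hintt hintS, htau]
  have hct : ∀ k, cpot (nu - S) k + cpot S k = cpot nu k := fun k => by
    rw [← cpot_add hintt hintS, htau]
  refine ecx_of_pot ?_ ?_ ?_
  · have hS' : S univ = mu1 univ := (measureReal_eq_measureReal_iff (measure_ne_top _ _)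
        (measure_ne_top _ _)).1 hSm
    have h1 : (nu - S) univ + S univ = nu univ := by
      rw [← Measure.add_apply, htau]
    rw [← h1, hS', add_comm] at hmass
    exact (ENNReal.add_le_add_iff_right (measure_ne_top _ _)).1 hmass
  · intro k
    rw [lint_put hint2, lint_put hintt]
    refine ENNReal.ofReal_le_ofReal ?_
    have h1 := hSput k
    have h2 := hpe k
    have h3 := hpt k
    have h4 := hH2 k
    linarith
  · intro k
    rw [lint_call hint2, lint_call hintt]
    refine ENNReal.ofReal_le_ofReal ?_
    have h1 := hScall k
    have h2 := hpe k
    have h3 := hct k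
    have h4 := hHL k
    have h5 := hpce k
    have h6 := hpcn k
    rw [hme', hbe'] at h5
    linarith
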